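/- Let ξ ∈ (0,1), let k_c > 0 be a constant, and let λ, ρ be degree distributions with the maximal degree of ρ at most k_c·a, where 1/a = ∫₀¹ ρ(x) dx; set b = 1/a, R = 1 − (∫₀¹ρ)/(∫₀¹λ), ΔR = (1−ξ) − R. Assume the successful decoding condition ξ·λ(1−ρ(1−x)) < x for all x ∈ (0, ξ]. Then for every x ∈ (0, ξ): x − ξ·λ(1−ρ(1−x)) ≤ √( 2·b·ΔR / ((ξ+ΔR)·ρ(1−x)) ). -/

import Mathlib

open scoped BigOperators

/-- A degree distribution: a real polynomial `γ(x) = ∑_{i=2}^{D} γ_i x^(i-1)` whose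
coefficients are nonnegative and sum to `1`; `D` (the largest index with `γ_D ≠ 0`)
is called the maximal degree. -/
structure DegreeDist where
  c : ℕ → ℝ
  D : ℕ
  two_le_D : 2 ≤ D
  nonneg : ∀ i, 0 ≤ c i
  supp : ∀ i, c i ≠ 0 → 2 ≤ i ∧ i ≤ D
  cD_ne : c D ≠ 0
  sum_eq_one : ∑ i ∈ Finset.Icc 2 D, c i = 1

/-- Evaluation of a degree distribution at a real `x`. -/
noncomputable def DegreeDist.eval (γ : DegreeDist) (x : ℝ) : ℝ :=
  ∑ i ∈ Finset.Icc 2 γ.D, γ.c i * x ^ (i - 1)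

namespace DegreeDist

/-- The formal derivative of a degree distribution, evaluated at a real `x`. -/
noncomputable def evalDeriv (γ : DegreeDist) (x : ℝ) : ℝ :=
  ∑ i ∈ Finset.Icc 2 γ.D, γ.c i * (((i - 1 : ℕ) : ℝ) * x ^ (i - 1 - 1))

lemma hasDerivAt_eval (γ : DegreeDist) (x : ℝ) : HasDerivAt γ.eval (γ.evalDeriv x) x :=
  HasDerivAt.fun_sum fun i _ => (hasDerivAt_pow (i - 1) x).const_mul (γ.c i)

lemma continuous_eval (γ : DegreeDist) : Continuous γ.eval := by
  unfold eval
  fun_prop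

lemma continuous_evalDeriv (γ : DegreeDist) : Continuous γ.evalDeriv := by
  unfold evalDeriv
  fun_prop

lemma eval_zero (γ : DegreeDist) : γ.eval 0 = 0 := by
  refine Finset.sum_eq_zero fun i hi => ?_
  have := Finset.mem_Icc.1 hi
  rw [zero_pow (by omega), mul_zero]

lemma eval_one (γ : DegreeDist) : γ.eval 1 = 1 := by
  simpa [eval] using γ.sum_eq_one

lemma eval_mono (γ : DegreeDist) {x y : ℝ} (hx : 0 ≤ x) (hxy : x ≤ y) :
    γ.eval x ≤ γ.eval y :=
  Finset.sum_le_sum fun i _ =>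
    mul_le_mul_of_nonneg_left (pow_le_pow_left₀ hx hxy _) (γ.nonneg i)

lemma evalDeriv_mono (γ : DegreeDist) {x y : ℝ} (hx : 0 ≤ x) (hxy : x ≤ y) :
    γ.evalDeriv x ≤ γ.evalDeriv y :=
  Finset.sum_le_sum fun i _ => mul_le_mul_of_nonneg_left
    (mul_le_mul_of_nonneg_left (pow_le_pow_left₀ hx hxy _) (Nat.cast_nonneg _)) (γ.nonneg i)

lemma eval_nonneg (γ : DegreeDist) {x : ℝ} (hx : 0 ≤ x) : 0 ≤ γ.eval x :=
  γ.eval_zero ▸ γ.eval_mono le_rfl hx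

lemma eval_le_one (γ : DegreeDist) {x : ℝ} (hx : 0 ≤ x) (hx1 : x ≤ 1) : γ.eval x ≤ 1 :=
  γ.eval_one ▸ γ.eval_mono hx hx1

lemma evalDeriv_nonneg (γ : DegreeDist) {x : ℝ} (hx : 0 ≤ x) : 0 ≤ γ.evalDeriv x :=
  Finset.sum_nonneg fun i _ => mul_nonneg (γ.nonneg i) (by positivity)

lemma eval_pos (γ : DegreeDist) {x : ℝ} (hx : 0 < x) : 0 < γ.eval x := by
  have hD : 0 < γ.c γ.D := (γ.nonneg _).lt_of_ne' γ.cD_ne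
  exact Finset.sum_pos' (fun i _ => mul_nonneg (γ.nonneg i) (by positivity))
    ⟨γ.D, Finset.mem_Icc.2 ⟨γ.two_le_D, le_rfl⟩, by positivity⟩

lemma eval_le_evalDeriv (γ : DegreeDist) {x : ℝ} (hx : 0 ≤ x) (hx1 : x ≤ 1) :
    γ.eval x ≤ γ.evalDeriv x := by
  refine Finset.sum_le_sum fun i hi => mul_le_mul_of_nonneg_left ?_ (γ.nonneg i)
  have hi2 : 1 ≤ i - 1 := by
    have := Finset.mem_Icc.1 hi
    omega
  calc x ^ (i - 1) ≤ x ^ (i - 1 - 1) := pow_le_pow_of_le_one hx hx1 (Nat.sub_le _ _)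
    _ ≤ ((i - 1 : ℕ) : ℝ) * x ^ (i - 1 - 1) :=
      le_mul_of_one_le_left (by positivity) (by exact_mod_cast hi2)

lemma integral_eval_pos (γ : DegreeDist) : 0 < ∫ x in (0:ℝ)..1, γ.eval x :=
  intervalIntegral.intervalIntegral_pos_of_pos_on (γ.continuous_eval.intervalIntegrable _ _)
    (fun _ hx => γ.eval_pos hx.1) one_pos

lemma hasDerivAt_one_sub_eval_one_sub (γ : DegreeDist) (x : ℝ) :
    HasDerivAt (fun x => 1 - γ.eval (1 - x)) (γ.evalDeriv (1 - x)) x := by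
  have h := ((γ.hasDerivAt_eval (1 - x)).comp x ((hasDerivAt_id x).const_sub 1)).const_sub 1
  simpa [Function.comp_def] using h

lemma continuous_evalDeriv_one_sub (γ : DegreeDist) :
    Continuous fun x => γ.evalDeriv (1 - x) :=
  γ.continuous_evalDeriv.comp (by fun_prop)

lemma integral_comp_mul_evalDeriv (γ : DegreeDist) {g : ℝ → ℝ} (hg : Continuous g) :
    ∫ x in (0:ℝ)..1, g (1 - γ.eval (1 - x)) * γ.evalDeriv (1 - x) = ∫ x in (0:ℝ)..1, g x := by
  have h := intervalIntegral.integral_comp_mul_deriv (a := 0) (b := 1)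
    (fun x _ => γ.hasDerivAt_one_sub_eval_one_sub x)
    γ.continuous_evalDeriv_one_sub.continuousOn hg
  simpa [eval_zero, eval_one] using h

lemma integral_id_mul_evalDeriv (γ : DegreeDist) :
    ∫ x in (0:ℝ)..1, x * γ.evalDeriv (1 - x) = ∫ x in (0:ℝ)..1, γ.eval x := by
  have h := intervalIntegral.integral_mul_deriv_eq_deriv_mul (a := 0) (b := 1)
    (fun x _ => hasDerivAt_id x) (fun x _ => γ.hasDerivAt_one_sub_eval_one_sub x)
    intervalIntegrable_const
    (γ.continuous_evalDeriv_one_sub.intervalIntegrable _ _)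
  have hsub : ∫ x in (0:ℝ)..1, γ.eval (1 - x) = ∫ x in (0:ℝ)..1, γ.eval x := by
    simp
  have hi : IntervalIntegrable (fun x => γ.eval (1 - x)) MeasureTheory.volume 0 1 :=
    (γ.continuous_eval.comp (by fun_prop : Continuous fun x : ℝ => 1 - x)).intervalIntegrable _ _
  simp only [id_eq, one_mul, sub_self, eval_zero] at h
  rw [h, intervalIntegral.integral_sub intervalIntegrable_const hi, hsub]
  simp

lemma integral_gap_mul_evalDeriv (lam ρ : DegreeDist) (ξ : ℝ) :
    ∫ x in (0:ℝ)..1, (x - ξ * lam.eval (1 - ρ.eval (1 - x))) * ρ.evalDeriv (1 - x) =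
      (∫ x in (0:ℝ)..1, ρ.eval x) - ξ * ∫ x in (0:ℝ)..1, lam.eval x := by
  have hl := lam.continuous_eval
  have hr := ρ.continuous_eval
  have hd := ρ.continuous_evalDeriv
  rw [← ρ.integral_id_mul_evalDeriv, ← ρ.integral_comp_mul_evalDeriv hl,
    ← intervalIntegral.integral_const_mul, ← intervalIntegral.integral_sub]
  · simp only [sub_mul, mul_assoc]
  · exact Continuous.intervalIntegrable (by fun_prop) _ _
  · exact Continuous.intervalIntegrable (by fun_prop) _ _

/-- Under the successful decoding condition, the area between the two decoding curves is at least
that of a triangle-like region below the gap at any single point. -/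
lemma sq_gap_mul_evalDeriv_le {lam ρ : DegreeDist} {ξ : ℝ} (hξ0 : 0 ≤ ξ)
    (hdec : ∀ x ∈ Set.Ioc (0:ℝ) ξ, ξ * lam.eval (1 - ρ.eval (1 - x)) < x)
    {x : ℝ} (hx0 : 0 ≤ x) (hx1 : x ≤ 1) :
    (x - ξ * lam.eval (1 - ρ.eval (1 - x))) ^ 2 * ρ.evalDeriv (1 - x) ≤
      2 * ((∫ t in (0:ℝ)..1, ρ.eval t) - ξ * ∫ t in (0:ℝ)..1, lam.eval t) := by
  have hl := lam.continuous_eval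
  have hr := ρ.continuous_eval
  have hd := ρ.continuous_evalDeriv
  have hu0 : ∀ t : ℝ, 0 ≤ t → t ≤ 1 → 0 ≤ 1 - ρ.eval (1 - t) := fun t h0 h1 =>
    sub_nonneg.2 (ρ.eval_le_one (by linarith) (by linarith))
  have hgap : ∀ t : ℝ, 0 ≤ t → t ≤ 1 → ξ * lam.eval (1 - ρ.eval (1 - t)) ≤ t := by
    intro t h0 h1
    rcases h0.eq_or_lt with rfl | h0'
    · simp [eval_one, eval_zero]
    rcases le_or_gt t ξ with h | h
    · exact (hdec t ⟨h0', h⟩).le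
    · have := lam.eval_le_one (hu0 t h0 h1)
        (by linarith [ρ.eval_nonneg (sub_nonneg.2 h1)])
      nlinarith
  set z := ξ * lam.eval (1 - ρ.eval (1 - x)) with hz
  have hz0 : 0 ≤ z := mul_nonneg hξ0 (lam.eval_nonneg (hu0 x hx0 hx1))
  have hzx : z ≤ x := hgap x hx0 hx1
  have hcont : Continuous fun t =>
      (t - ξ * lam.eval (1 - ρ.eval (1 - t))) * ρ.evalDeriv (1 - t) := by fun_prop
  have hsub : ∫ t in z..x, (t - ξ * lam.eval (1 - ρ.eval (1 - t))) * ρ.evalDeriv (1 - t) ≤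
      ∫ t in (0:ℝ)..1, (t - ξ * lam.eval (1 - ρ.eval (1 - t))) * ρ.evalDeriv (1 - t) := by
    refine intervalIntegral.integral_mono_interval hz0 hzx hx1 ?_ (hcont.intervalIntegrable _ _)
    filter_upwards [MeasureTheory.ae_restrict_mem measurableSet_Ioc] with t ht
    exact mul_nonneg (sub_nonneg.2 (hgap t ht.1.le ht.2))
      (ρ.evalDeriv_nonneg (sub_nonneg.2 ht.2))
  have hlow : ∫ t in z..x, (t - z) * ρ.evalDeriv (1 - x) ≤
      ∫ t in z..x, (t - ξ * lam.eval (1 - ρ.eval (1 - t))) * ρ.evalDeriv (1 - t) := by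
    refine intervalIntegral.integral_mono_on hzx
      (Continuous.intervalIntegrable (by fun_prop) _ _) (hcont.intervalIntegrable _ _) ?_
    intro t ht
    have ht0 : 0 ≤ t := hz0.trans ht.1
    have ht1 : t ≤ 1 := ht.2.trans hx1
    refine mul_le_mul ?_ (ρ.evalDeriv_mono (sub_nonneg.2 hx1) (by linarith [ht.2]))
      (ρ.evalDeriv_nonneg (sub_nonneg.2 hx1)) (sub_nonneg.2 (hgap t ht0 ht1))
    have hmono := ρ.eval_mono (sub_nonneg.2 hx1) (show 1 - x ≤ 1 - t by linarith [ht.2])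
    have := mul_le_mul_of_nonneg_left
      (lam.eval_mono (hu0 t ht0 ht1) (sub_le_sub_left hmono 1)) hξ0
    linarith
  have hval : ∫ t in z..x, (t - z) * ρ.evalDeriv (1 - x) =
      (x - z) ^ 2 / 2 * ρ.evalDeriv (1 - x) := by
    rw [intervalIntegral.integral_mul_const, intervalIntegral.integral_sub
      intervalIntegral.intervalIntegrable_id intervalIntegrable_const, integral_id,
      intervalIntegral.integral_const, smul_eq_mul]
    ring
  rw [integral_gap_mul_evalDeriv] at hsub
  linarith

end DegreeDist

/-- `x − ξλ(1−ρ(1−x)) ≤ √(2bΔR/((ξ+ΔR)·ρ(1−x)))` on `(0, ξ)`. -/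
theorem stmt10 (ξ a b R dR kc : ℝ) (hξ : ξ ∈ Set.Ioo (0:ℝ) 1) (hkc : 0 < kc)
    (lam ρ : DegreeDist)
    (hdeg : (ρ.D : ℝ) ≤ kc * a)
    (ha : 1 / a = ∫ x in (0:ℝ)..1, ρ.eval x)
    (hb : b = 1 / a)
    (hR : R = 1 - (∫ x in (0:ℝ)..1, ρ.eval x) / (∫ x in (0:ℝ)..1, lam.eval x))
    (hdR : dR = (1 - ξ) - R)
    (hdec : ∀ x ∈ Set.Ioc (0:ℝ) ξ, ξ * lam.eval (1 - ρ.eval (1 - x)) < x) :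
    ∀ x ∈ Set.Ioo (0:ℝ) ξ,
      x - ξ * lam.eval (1 - ρ.eval (1 - x)) ≤
        Real.sqrt (2 * b * dR / ((ξ + dR) * ρ.eval (1 - x))) := by
  intro x hx
  have hx1 : x ≤ 1 := hx.2.le.trans hξ.2.le
  have hρ : 0 < ρ.eval (1 - x) := ρ.eval_pos (by linarith [hx.2, hξ.2])
  have hP := ρ.integral_eval_pos
  have hL := lam.integral_eval_pos
  have harea := DegreeDist.sq_gap_mul_evalDeriv_le hξ.1.le hdec hx.1.le hx1
  have hle := ρ.eval_le_evalDeriv (sub_nonneg.2 hx1) (by linarith [hx.1])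
  rw [← hb] at ha
  have hsum : ξ + dR = b / ∫ x in (0:ℝ)..1, lam.eval x := by
    rw [hdR, hR, ha]
    ring
  rw [← ha] at harea hP
  apply Real.le_sqrt_of_sq_le
  have hdR' : dR = b / (∫ x in (0:ℝ)..1, lam.eval x) - ξ := by linarith
  have hval : 2 * b * dR / ((ξ + dR) * ρ.eval (1 - x)) =
      2 * (b - ξ * ∫ x in (0:ℝ)..1, lam.eval x) / ρ.eval (1 - x) := by
    rw [hsum, hdR']
    field_simp
  rw [hval, le_div_iff₀ hρ]
  exact (mul_le_mul_of_nonneg_left hle (sq_nonneg _)).trans harea
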